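/- For every real t > 0 and every natural number m, (∂²I_ν(t)/∂ν²)|_{ν=m} − (∂²I_ν(t)/∂ν²)|_{ν=−m} = 4·(−1)^{m+1}·(∂K_ν(t)/∂ν)|_{ν=m}. -/

import Mathlib

open Real MeasureTheory

/-- Modified Bessel function of the first kind via its integral representation. -/
noncomputable def besselI (ν t : ℝ) : ℝ :=
  (1 / π) * ∫ x in (0:ℝ)..π, Real.exp (t * Real.cos x) * Real.cos (ν * x)
    - (Real.sin (ν * π) / π) * ∫ x in Set.Ioi (0:ℝ), Real.exp (-(t * Real.cosh x) - ν * x)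

/-- Modified Bessel function of the second kind (Macdonald function). -/
noncomputable def besselK (ν t : ℝ) : ℝ :=
  (1 / 2) * ∫ x : ℝ, Real.exp (ν * x - t * Real.cosh x)

section ExponentialIntegral

variable {μ : Measure ℝ} {w : ℝ → ℝ}

lemma integral_withDensity_ofReal_eq {E : Type*} [NormedAddCommGroup E] [NormedSpace ℝ E]
    (hw : Measurable w) (hw0 : ∀ x, 0 ≤ w x) (g : ℝ → E) :
    ∫ x, g x ∂(μ.withDensity fun x => ENNReal.ofReal (w x)) = ∫ x, w x • g x ∂μ := by
  rw [integral_withDensity_eq_integral_toReal_smul hw.ennreal_ofReal (by simp)]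
  simp [ENNReal.toReal_ofReal (hw0 _)]

lemma mem_interior_integrableExpSet_withDensity (hw : Measurable w) (hw0 : ∀ x, 0 ≤ w x)
    (h : ∀ ν : ℝ, Integrable (fun x => w x * exp (ν * x)) μ) (ν : ℝ) :
    ν ∈ interior (ProbabilityTheory.integrableExpSet id
      (μ.withDensity fun x => ENNReal.ofReal (w x))) := by
  have huniv : ProbabilityTheory.integrableExpSet id
      (μ.withDensity fun x => ENNReal.ofReal (w x)) = Set.univ := by
    refine Set.eq_univ_of_forall fun s => ?_
    change Integrable _ _
    rw [integrable_withDensity_iff_integrable_smul' hw.ennreal_ofReal (by simp)]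
    simpa [ENNReal.toReal_ofReal (hw0 _)] using h s
  simp [huniv]

/-- The two-sided Laplace transform of an everywhere exponentially integrable weight is smooth. -/
lemma contDiff_integral_mul_exp (hw : Measurable w) (hw0 : ∀ x, 0 ≤ w x)
    (h : ∀ ν : ℝ, Integrable (fun x => w x * exp (ν * x)) μ) {n : WithTop ℕ∞} :
    ContDiff ℝ n (fun ν : ℝ => ∫ x, w x * exp (ν * x) ∂μ) := by
  have hmgf : (fun ν : ℝ => ∫ x, w x * exp (ν * x) ∂μ) =
      ProbabilityTheory.mgf id (μ.withDensity fun x => ENNReal.ofReal (w x)) := by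
    funext ν
    simp [ProbabilityTheory.mgf, integral_withDensity_ofReal_eq hw hw0]
  rw [hmgf, contDiff_iff_contDiffAt]
  exact fun ν => (ProbabilityTheory.analyticAt_mgf
    (mem_interior_integrableExpSet_withDensity hw hw0 h ν)).contDiffAt

/-- The cosine transform of an everywhere exponentially integrable weight is smooth. -/
lemma contDiff_integral_mul_cos (hw : Measurable w) (hw0 : ∀ x, 0 ≤ w x)
    (h : ∀ ν : ℝ, Integrable (fun x => w x * exp (ν * x)) μ) {n : WithTop ℕ∞} :
    ContDiff ℝ n (fun ν : ℝ => ∫ x, w x * cos (ν * x) ∂μ) := by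
  have hw1 : Integrable w μ := by simpa using h 0
  have hre : (fun ν : ℝ => ∫ x, w x * cos (ν * x) ∂μ) = fun ν : ℝ =>
      (ProbabilityTheory.complexMGF id (μ.withDensity fun x => ENNReal.ofReal (w x))
        (Complex.I * ν)).re := by
    funext ν
    rw [ProbabilityTheory.complexMGF, integral_withDensity_ofReal_eq hw hw0]
    have hint : Integrable (fun x : ℝ => w x • Complex.exp (Complex.I * ν * (id x : ℝ))) μ := by
      refine hw1.mono (by fun_prop) (.of_forall fun x => ?_)
      simp [Complex.norm_exp]
    refine Eq.trans ?_ (integral_re hint)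
    refine integral_congr_ae (.of_forall fun x => ?_)
    simp [Complex.exp_re]
  rw [hre, contDiff_iff_contDiffAt]
  intro ν
  have hz : (Complex.I * (ν : ℂ)).re ∈ interior (ProbabilityTheory.integrableExpSet id
      (μ.withDensity fun x => ENNReal.ofReal (w x))) :=
    mem_interior_integrableExpSet_withDensity hw hw0 h _
  have hc : AnalyticAt ℂ (fun z : ℂ =>
      ProbabilityTheory.complexMGF id (μ.withDensity fun x => ENNReal.ofReal (w x))
        (Complex.I * z)) (ν : ℂ) :=
    (ProbabilityTheory.analyticAt_complexMGF hz).fun_comp (by fun_prop)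
  exact hc.re_ofReal.contDiffAt

end ExponentialIntegral

lemma sq_div_four_le_cosh (x : ℝ) : x ^ 2 / 4 ≤ cosh x := by
  have h1 := quadratic_le_exp_of_nonneg (abs_nonneg x)
  have h2 := exp_pos (-|x|)
  rw [← cosh_abs, cosh_eq]
  rw [sq_abs] at h1
  linarith [abs_nonneg x]

lemma integrable_exp_neg_cosh_mul_exp {t : ℝ} (ht : 0 < t) (ν : ℝ) :
    Integrable (fun x : ℝ => exp (-(t * cosh x)) * exp (ν * x)) := by
  refine ((integrable_exp_neg_mul_sq (by positivity : 0 < t / 8)).const_mul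
    (exp (2 * ν ^ 2 / t))).mono' (by fun_prop) (.of_forall fun x => ?_)
  rw [norm_of_nonneg (by positivity), ← exp_add, ← exp_add, exp_le_exp]
  have h1 := mul_le_mul_of_nonneg_left (sq_div_four_le_cosh x) ht.le
  have h2 : 2 * ν ^ 2 / t + t / 8 * x ^ 2 - ν * x = (4 * ν - t * x) ^ 2 / (8 * t) := by
    field_simp
    ring
  have h3 : 0 ≤ (4 * ν - t * x) ^ 2 / (8 * t) := by positivity
  linarith

lemma contDiff_integral_Ioi_exp_neg_cosh {t : ℝ} (ht : 0 < t) {n : WithTop ℕ∞} :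
    ContDiff ℝ n (fun ν : ℝ => ∫ x in Set.Ioi (0 : ℝ), exp (-(t * cosh x) - ν * x)) := by
  have h := contDiff_integral_mul_exp (n := n) (μ := volume.restrict (Set.Ioi 0))
    (w := fun x => exp (-(t * cosh x))) (by fun_prop) (fun x => (exp_pos _).le)
    (fun ν => (integrable_exp_neg_cosh_mul_exp ht ν).integrableOn)
  convert h.comp contDiff_neg using 2 with ν
  refine integral_congr_ae (.of_forall fun x => ?_)
  simp only [← exp_add]
  ring_nf

/-- In `besselI` the body of the integral over `[0, π]` extends over the subtracted term. Since that
term is constant in `x`, the factor `1 / π` cancels the length of the interval. -/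
lemma besselI_eq_sub (ν t : ℝ) :
    besselI ν t = ((1 / π) * ∫ x in (0 : ℝ)..π, exp (t * cos x) * cos (ν * x))
      - (sin (ν * π) / π) * ∫ x in Set.Ioi (0 : ℝ), exp (-(t * cosh x) - ν * x) := by
  rw [besselI, intervalIntegral.integral_sub
    (Continuous.intervalIntegrable (by fun_prop) _ _) intervalIntegrable_const,
    intervalIntegral.integral_const, smul_eq_mul, sub_zero, mul_sub, ← mul_assoc (1 / π) π,
    one_div_mul_cancel pi_ne_zero, one_mul]

lemma contDiff_besselI {t : ℝ} (ht : 0 < t) {n : WithTop ℕ∞} :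
    ContDiff ℝ n (fun ν : ℝ => besselI ν t) := by
  have hC : ContDiff ℝ n
      (fun ν : ℝ => ∫ x in (0 : ℝ)..π, exp (t * cos x) * cos (ν * x)) := by
    simp only [intervalIntegral.integral_of_le pi_pos.le]
    refine contDiff_integral_mul_cos (w := fun x => exp (t * cos x)) (by fun_prop)
      (fun x => (exp_pos _).le) (fun ν => ?_)
    exact (Continuous.integrableOn_Icc (by fun_prop)).mono_set Set.Ioc_subset_Icc_self
  have hJ := contDiff_integral_Ioi_exp_neg_cosh ht (n := n)
  have hs : ContDiff ℝ n (fun ν : ℝ => sin (ν * π) / π) := by fun_prop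
  simp only [besselI_eq_sub]
  exact (contDiff_const.mul hC).sub (hs.mul hJ)

lemma besselK_eq_integral_Ioi {t : ℝ} (ht : 0 < t) (ν : ℝ) :
    besselK ν t = (1 / 2) * ((∫ x in Set.Ioi (0 : ℝ), exp (-(t * cosh x) - ν * x))
      + ∫ x in Set.Ioi (0 : ℝ), exp (-(t * cosh x) - (-ν) * x)) := by
  have hint : Integrable (fun x : ℝ => exp (ν * x - t * cosh x)) := by
    convert integrable_exp_neg_cosh_mul_exp ht ν using 2 with x
    rw [← exp_add]
    ring_nf
  have hneg := integral_comp_neg_Ioi (0 : ℝ) (fun x : ℝ => exp (ν * x - t * cosh x))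
  rw [besselK, ← intervalIntegral.integral_Iic_add_Ioi (b := 0) hint.integrableOn hint.integrableOn]
  rw [neg_zero] at hneg
  rw [← hneg]
  congr! 5 <;> simp <;> ring

lemma contDiff_besselK {t : ℝ} (ht : 0 < t) {n : WithTop ℕ∞} :
    ContDiff ℝ n (fun ν : ℝ => besselK ν t) := by
  have hJ := contDiff_integral_Ioi_exp_neg_cosh ht (n := n)
  simp only [besselK_eq_integral_Ioi ht]
  exact contDiff_const.mul (hJ.add (hJ.comp contDiff_neg))

/-- The reflection formula for the modified Bessel functions. -/
lemma besselI_sub_besselI_neg {t : ℝ} (ht : 0 < t) (ν : ℝ) :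
    besselI ν t - besselI (-ν) t = -(2 / π) * (sin (ν * π) * besselK ν t) := by
  rw [besselK_eq_integral_Ioi ht, besselI_eq_sub, besselI_eq_sub]
  simp only [neg_mul, cos_neg, sin_neg]
  ring

lemma iteratedDeriv_two_sin_mul_natCast {f : ℝ → ℝ} (hf : ContDiff ℝ 2 f) (m : ℕ) :
    iteratedDeriv 2 (fun ν : ℝ => sin (ν * π) * f ν) m = 2 * π * (-1) ^ m * deriv f m := by
  have hsin (ν : ℝ) : HasDerivAt (fun ν : ℝ => sin (ν * π)) (cos (ν * π) * π) ν := by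
    simpa using ((hasDerivAt_id ν).mul_const π).sin
  have hcos (ν : ℝ) : HasDerivAt (fun ν : ℝ => cos (ν * π)) (-sin (ν * π) * π) ν := by
    simpa using ((hasDerivAt_id ν).mul_const π).cos
  have hf1 (ν : ℝ) : HasDerivAt f (deriv f ν) ν :=
    (hf.differentiable (by norm_num) ν).hasDerivAt
  have hf2 : HasDerivAt (deriv f) (deriv (deriv f) m) m :=
    ((hf.deriv' (n := 1)).differentiable (by norm_num) _).hasDerivAt
  have hd : deriv (fun ν : ℝ => sin (ν * π) * f ν) =
      fun ν => cos (ν * π) * π * f ν + sin (ν * π) * deriv f ν :=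
    funext fun ν => ((hsin ν).mul (hf1 ν)).deriv
  rw [iteratedDeriv_succ, iteratedDeriv_one, hd,
    ((((hcos m).mul_const π).fun_mul (hf1 m)).fun_add ((hsin m).fun_mul hf2)).deriv,
    sin_nat_mul_pi, cos_nat_mul_pi]
  ring

theorem reflection_second_deriv_besselI (t : ℝ) (ht : 0 < t) (m : ℕ) :
    iteratedDeriv 2 (fun ν : ℝ => besselI ν t) m
      - iteratedDeriv 2 (fun ν : ℝ => besselI ν t) (-(m : ℝ))
      = 4 * (-1 : ℝ) ^ (m + 1) * deriv (fun ν : ℝ => besselK ν t) m := by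
  have hI := contDiff_besselI ht (n := 2)
  have hneg := iteratedDeriv_comp_neg 2 (fun ν : ℝ => besselI ν t) (m : ℝ)
  rw [neg_one_sq, one_smul] at hneg
  have hI' : ContDiff ℝ 2 (fun ν : ℝ => besselI (-ν) t) := hI.comp contDiff_neg
  rw [← hneg, ← iteratedDeriv_fun_sub hI.contDiffAt hI'.contDiffAt]
  simp only [besselI_sub_besselI_neg ht]
  rw [iteratedDeriv_const_mul_field, iteratedDeriv_two_sin_mul_natCast (contDiff_besselK ht)]
  field_simp
  ring
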